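/- Let T be a tree on n vertices that is neither a path nor a star, and let S be the bi-coloured system derived from T. Then the number of distinct red lines of S satisfies m_S(R) ≥ C(a,2) + a + 1, where a is the number of leaves of T having at least one twin. -/

import Mathlib

/-- Three vertices `x, y, z` of a graph are collinear if one of them lies on a
shortest path (in a tree: the unique path) between the other two, i.e.
`d(x,y) + d(y,z) = d(x,z)` for some ordering of the triple. -/
def Collin {V : Type*} (G : SimpleGraph V) (x y z : V) : Prop :=
  G.dist x y + G.dist y z = G.dist x z ∨
  G.dist y x + G.dist x z = G.dist y z ∨
  G.dist x z + G.dist z y = G.dist x y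

/-- The red line generated by two distinct vertices `u`, `v` in the bi-coloured
system derived from the graph `G`: a triple is red iff it is collinear. -/
def treeRedLine {V : Type*} (G : SimpleGraph V) (u v : V) : Set V :=
  {u, v} ∪ {p | p ≠ u ∧ p ≠ v ∧ Collin G u v p}

/-- The blue line generated by two distinct vertices `u`, `v` in the bi-coloured
system derived from the graph `G`: a triple is blue iff it is not collinear. -/
def treeBlueLine {V : Type*} (G : SimpleGraph V) (u v : V) : Set V :=
  {u, v} ∪ {p | p ≠ u ∧ p ≠ v ∧ ¬ Collin G u v p}

/-- The set of distinct red lines of the system derived from `G`. -/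
def treeRedLines {V : Type*} (G : SimpleGraph V) : Set (Set V) :=
  {L | ∃ u v : V, u ≠ v ∧ L = treeRedLine G u v}

/-- The set of distinct blue lines of the system derived from `G`. -/
def treeBlueLines {V : Type*} (G : SimpleGraph V) : Set (Set V) :=
  {L | ∃ u v : V, u ≠ v ∧ L = treeBlueLine G u v}

/-- `m_S(R)`, the number of distinct red lines of the system derived from `G`. -/
noncomputable def treeNumRed {V : Type*} (G : SimpleGraph V) : ℕ :=
  (treeRedLines G).ncard

/-- `m_S(B)`, the number of distinct blue lines of the system derived from `G`. -/
noncomputable def treeNumBlue {V : Type*} (G : SimpleGraph V) : ℕ :=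
  (treeBlueLines G).ncard

/-- Two vertices are twins if they are distinct, non-adjacent and have identical
neighbourhoods. -/
def Twins {V : Type*} (G : SimpleGraph V) (x y : V) : Prop :=
  x ≠ y ∧ ¬ G.Adj x y ∧ G.neighborSet x = G.neighborSet y

/-- The set of leaves of `G` having at least one twin (the set `A`). -/
def twinLeaves {V : Type*} (G : SimpleGraph V) : Set V :=
  {v | (G.neighborSet v).ncard = 1 ∧ ∃ w, Twins G v w}

/-- A twin class of a graph: a maximal set of at least two pairwise twin
vertices, i.e. the set consisting of a vertex `v` having a twin together with
all twins of `v`. -/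
def IsTwinClass {V : Type*} (G : SimpleGraph V) (C : Set V) : Prop :=
  ∃ v w : V, Twins G v w ∧ C = {u | u = v ∨ Twins G v u}

/-- `s`, the number of twin classes of `G`. -/
noncomputable def numTwinClasses {V : Type*} (G : SimpleGraph V) : ℕ :=
  {C : Set V | IsTwinClass G C}.ncard

namespace SimpleGraph

variable {V : Type*} {G : SimpleGraph V}

theorem Connected.dist_of_neighborSet_eq_singleton (hG : G.Connected) {x c p : V}
    (hx : G.neighborSet x = {c}) (hp : p ≠ x) : G.dist x p = G.dist c p + 1 := by
  have hxc : G.Adj x c := by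
    have h : c ∈ G.neighborSet x := by simp [hx]
    exact h
  apply le_antisymm
  · have h := hG.dist_triangle (u := x) (v := c) (w := p)
    rw [dist_eq_one_iff_adj.2 hxc] at h
    omega
  · obtain ⟨w, hw⟩ := hG.exists_walk_length_eq_dist x p
    cases w with
    | nil => exact absurd rfl hp
    | @cons _ v _ h q =>
      have hv : v ∈ G.neighborSet x := h
      rw [hx, Set.mem_singleton_iff] at hv
      subst hv
      rw [← hw, Walk.length_cons]
      exact Nat.add_le_add_right (dist_le q) 1

theorem Connected.exists_adj_dist_add_one_eq (hG : G.Connected) {c w : V} (hw : w ≠ c) :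
    ∃ d, G.Adj c d ∧ G.dist d w + 1 = G.dist c w := by
  obtain ⟨q, hq⟩ := hG.exists_walk_length_eq_dist c w
  cases q with
  | nil => exact absurd rfl hw
  | @cons _ d _ h q =>
    refine ⟨d, h, ?_⟩
    have h1 := dist_le q
    have h2 := hG.dist_triangle (u := c) (v := d) (w := w)
    rw [dist_eq_one_iff_adj.2 h] at h2
    rw [Walk.length_cons] at hq
    omega

end SimpleGraph

open SimpleGraph

theorem Twins.symm {V : Type*} {G : SimpleGraph V} {x y : V} (h : Twins G x y) :
    Twins G y x :=
  ⟨h.1.symm, fun hadj => h.2.1 hadj.symm, h.2.2.symm⟩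

theorem Twins.mem_twinLeaves {V : Type*} {G : SimpleGraph V} {x y : V} (h : Twins G x y)
    (hx : x ∈ twinLeaves G) : y ∈ twinLeaves G :=
  ⟨h.2.2 ▸ hx.1, x, h.symm⟩

theorem mem_treeRedLine_left {V : Type*} (G : SimpleGraph V) (u v : V) :
    u ∈ treeRedLine G u v := by simp [treeRedLine]

theorem mem_treeRedLine_right {V : Type*} (G : SimpleGraph V) (u v : V) :
    v ∈ treeRedLine G u v := by simp [treeRedLine]

theorem mem_treeRedLine_iff_collin {V : Type*} {G : SimpleGraph V} {u v p : V} (hu : p ≠ u)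
    (hv : p ≠ v) : p ∈ treeRedLine G u v ↔ Collin G u v p := by
  simp [treeRedLine, hu, hv]

theorem exists_neighborSet_eq_of_mem_twinLeaves {V : Type*} {G : SimpleGraph V} {x : V}
    (hx : x ∈ twinLeaves G) : ∃ c, G.neighborSet x = {c} :=
  Set.ncard_eq_one.1 hx.1

/-- The red line spanned by a leaf and its neighbour is the whole vertex set. -/
theorem treeRedLine_leaf_neighbor {V : Type*} {G : SimpleGraph V} (hG : G.Connected) {x c : V}
    (hx : G.neighborSet x = {c}) : treeRedLine G x c = Set.univ := by
  have hxc : G.Adj x c := by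
    have h : c ∈ G.neighborSet x := by simp [hx]
    exact h
  ext p
  simp only [Set.mem_univ, iff_true]
  by_cases hpx : p = x
  · exact hpx ▸ mem_treeRedLine_left G _ _
  by_cases hpc : p = c
  · exact hpc ▸ mem_treeRedLine_right G _ _
  rw [mem_treeRedLine_iff_collin hpx hpc]
  left
  rw [dist_eq_one_iff_adj.2 hxc, hG.dist_of_neighborSet_eq_singleton hx hpx]
  omega

/-- A leaf lies strictly between no two other vertices. -/
theorem dist_lt_of_leaf {V : Type*} {G : SimpleGraph V} (hG : G.Connected) {x y z : V}
    (hx : x ∈ twinLeaves G) (hy : y ≠ x) (hz : z ≠ x) :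
    G.dist y z < G.dist x y + G.dist x z := by
  obtain ⟨c, hc⟩ := exists_neighborSet_eq_of_mem_twinLeaves hx
  have h := hG.dist_triangle (u := y) (v := c) (w := z)
  rw [hG.dist_of_neighborSet_eq_singleton hc hy, hG.dist_of_neighborSet_eq_singleton hc hz]
  rw [G.dist_comm (u := y) (v := c)] at h
  omega

theorem treeRedLine_inter_twinLeaves {V : Type*} {G : SimpleGraph V} (hG : G.Connected) {y z : V}
    (hy : y ∈ twinLeaves G) (hz : z ∈ twinLeaves G) (hyz : y ≠ z) :
    treeRedLine G y z ∩ twinLeaves G = {y, z} := by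
  ext p
  constructor
  · rintro ⟨hp, hpA⟩
    by_contra hne
    simp only [Set.mem_insert_iff, Set.mem_singleton_iff, not_or] at hne
    rw [mem_treeRedLine_iff_collin hne.1 hne.2] at hp
    have h1 := dist_lt_of_leaf hG hpA (Ne.symm hne.1) (Ne.symm hne.2)
    have h2 := dist_lt_of_leaf hG hy hyz.symm hne.1
    have h3 := dist_lt_of_leaf hG hz hyz hne.2
    unfold Collin at hp
    have e1 := G.dist_comm (u := y) (v := z)
    have e2 := G.dist_comm (u := y) (v := p)
    have e3 := G.dist_comm (u := z) (v := p)
    omega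
  · rintro (rfl | rfl)
    · exact ⟨mem_treeRedLine_left G _ _, hy⟩
    · exact ⟨mem_treeRedLine_right G _ _, hz⟩

theorem Twins.dist_eq {V : Type*} {G : SimpleGraph V} (hG : G.Connected) {y z p : V}
    (hyz : Twins G y z) (hy : y ∈ twinLeaves G) (hpy : p ≠ y) (hpz : p ≠ z) :
    G.dist y p = G.dist z p := by
  obtain ⟨c, hc⟩ := exists_neighborSet_eq_of_mem_twinLeaves hy
  rw [hG.dist_of_neighborSet_eq_singleton hc hpy,
    hG.dist_of_neighborSet_eq_singleton (hyz.2.2 ▸ hc) hpz]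

theorem Twins.mem_treeRedLine_iff {V : Type*} {G : SimpleGraph V} (hG : G.Connected)
    {u v y z : V} (hyz : Twins G y z) (hy : y ∈ twinLeaves G) (hyu : y ≠ u) (hyv : y ≠ v)
    (hzu : z ≠ u) (hzv : z ≠ v) : y ∈ treeRedLine G u v ↔ z ∈ treeRedLine G u v := by
  rw [mem_treeRedLine_iff_collin hyu hyv, mem_treeRedLine_iff_collin hzu hzv]
  unfold Collin
  rw [G.dist_comm (u := v) (v := y), G.dist_comm (u := u) (v := y),
    G.dist_comm (u := v) (v := z), G.dist_comm (u := u) (v := z),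
    hyz.dist_eq hG hy hyu.symm hzu.symm, hyz.dist_eq hG hy hyv.symm hzv.symm]

theorem treeRedLine_pair_ne_univ {V : Type*} {G : SimpleGraph V} (hG : G.Connected)
    (hstar : ¬ ∃ v : V, ∀ w : V, w ≠ v → G.Adj v w) {y z : V}
    (hy : y ∈ twinLeaves G) (hz : z ∈ twinLeaves G) (hyz : y ≠ z) :
    treeRedLine G y z ≠ Set.univ := by
  intro huniv
  have hA := treeRedLine_inter_twinLeaves hG hy hz hyz
  rw [huniv, Set.univ_inter] at hA
  obtain ⟨t, ht⟩ := hy.2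
  have htA := ht.mem_twinLeaves hy
  rw [hA] at htA
  rcases htA with rfl | rfl
  · exact ht.1 rfl
  obtain ⟨c, hc⟩ := exists_neighborSet_eq_of_mem_twinLeaves hy
  have hc' := ht.2.2 ▸ hc
  apply hstar
  refine ⟨c, fun w hw => ?_⟩
  have hyc : G.Adj y c := by
    have h : c ∈ G.neighborSet y := by simp [hc]
    exact h
  have htc : G.Adj t c := by
    have h : c ∈ G.neighborSet t := by simp [hc']
    exact h
  by_cases hwy : w = y
  · exact hwy ▸ hyc.symm
  by_cases hwt : w = t
  · exact hwt ▸ htc.symm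
  have hmem : w ∈ treeRedLine G y t := huniv ▸ Set.mem_univ w
  rw [mem_treeRedLine_iff_collin hwy hwt] at hmem
  unfold Collin at hmem
  have h1 := ht.dist_eq hG hy hwy hwt
  have h2 := hG.dist_of_neighborSet_eq_singleton hc hwy
  have h3 := hG.dist_of_neighborSet_eq_singleton hc hyz.symm
  rw [dist_eq_one_iff_adj.2 htc.symm] at h3
  have h4 := hG.pos_dist_of_ne hw.symm
  have e1 := G.dist_comm (u := t) (v := y)
  have e2 := G.dist_comm (u := t) (v := w)
  rw [← dist_eq_one_iff_adj]
  omega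

/-- Every leaf with a twin lies on a red line that omits all of its twins and contains, with any
other such leaf, all of that leaf's twins. -/
theorem exists_treeRedLine_separating_twins {V : Type*} {G : SimpleGraph V} (hG : G.Connected)
    (hstar : ¬ ∃ v : V, ∀ w : V, w ≠ v → G.Adj v w) {x : V} (hx : x ∈ twinLeaves G) :
    ∃ L ∈ treeRedLines G, x ∈ L ∧ (∀ y, Twins G x y → y ∉ L) ∧
      ∀ y z, y ∈ L → y ∈ twinLeaves G → y ≠ x → Twins G y z → z ∈ L := by
  obtain ⟨c, hc⟩ := exists_neighborSet_eq_of_mem_twinLeaves hx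
  have hadj : ∀ {y}, G.neighborSet y = {c} → G.Adj y c := fun {y} hy => by
    have h : c ∈ G.neighborSet y := by simp [hy]
    exact h
  push Not at hstar
  obtain ⟨w, hwc, hw⟩ := hstar c
  obtain ⟨d, hcd, hdw⟩ := hG.exists_adj_dist_add_one_eq hwc
  have hdA : d ∉ twinLeaves G := fun hd => by
    obtain ⟨e, he⟩ := exists_neighborSet_eq_of_mem_twinLeaves hd
    have hce : c ∈ G.neighborSet d := hcd.symm
    rw [he, Set.mem_singleton_iff] at hce
    subst hce
    have hwd : w ≠ d := fun h => hw (h ▸ hcd)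
    have := hG.dist_of_neighborSet_eq_singleton he hwd
    omega
  have hne : ∀ {y}, y ∈ twinLeaves G → y ≠ d := fun hy h => hdA (h ▸ hy)
  have htwin : ∀ y, Twins G x y → y ∉ treeRedLine G x d := fun y hy hmem => by
    have hyA := hy.mem_twinLeaves hx
    have hyc := hy.2.2 ▸ hc
    rw [mem_treeRedLine_iff_collin hy.1.symm (hne hyA)] at hmem
    have h1 := hG.dist_of_neighborSet_eq_singleton hc hy.1.symm
    have h2 := hG.dist_of_neighborSet_eq_singleton hc (hne hx).symm
    have h3 := hG.dist_of_neighborSet_eq_singleton hyc (hne hyA).symm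
    rw [dist_eq_one_iff_adj.2 hcd] at h2 h3
    rw [dist_eq_one_iff_adj.2 (hadj hyc).symm] at h1
    unfold Collin at hmem
    have e1 := G.dist_comm (u := d) (v := x)
    have e2 := G.dist_comm (u := d) (v := y)
    omega
  refine ⟨treeRedLine G x d, ⟨x, d, hne hx, rfl⟩, mem_treeRedLine_left G _ _, htwin, ?_⟩
  intro y z hyL hyA hyx hyz
  have hzx : z ≠ x := fun h => htwin y (h ▸ hyz.symm) hyL
  exact (hyz.mem_treeRedLine_iff hG hyA hyx (hne hyA) hzx
    (hne (hyz.mem_twinLeaves hyA))).1 hyL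

/-- For a tree `T` on `n` vertices that is neither a path nor a star, the number
of distinct red lines of the derived system is at least `C(a,2) + a + 1`, where
`a` is the number of leaves having at least one twin. -/
theorem stmt_14 {V : Type*} [Fintype V] (G : SimpleGraph V) (hG : G.IsTree)
    (hnotpath : ¬ Nonempty (G ≃g SimpleGraph.pathGraph (Fintype.card V)))
    (hnotstar : ¬ ∃ v : V, ∀ w : V, w ≠ v → G.Adj v w) :
    Nat.choose (twinLeaves G).ncard 2 + (twinLeaves G).ncard + 1 ≤
      treeNumRed G := by
  classical
  have hconn := hG.connected
  set A := (twinLeaves G).toFinset with hA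
  have hmemA : ∀ {v}, v ∈ A ↔ v ∈ twinLeaves G := by simp [hA]
  have hcard : (twinLeaves G).ncard = A.card := Set.ncard_eq_toFinset_card' _
  rw [hcard]
  have hfin : (treeRedLines G).Finite := Set.toFinite _
  rcases A.eq_empty_or_nonempty with hempty | ⟨x₀, hx₀⟩
  · obtain ⟨v⟩ := hconn.nonempty
    push Not at hnotstar
    obtain ⟨w, hwv, -⟩ := hnotstar v
    have hpos : 0 < treeNumRed G :=
      (Set.ncard_pos hfin).2 ⟨treeRedLine G w v, w, v, hwv, rfl⟩
    simpa [hempty] using Nat.one_le_iff_ne_zero.2 hpos.ne'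
  have hpair : ∀ s : Finset V, ∃ L : Set V, s ∈ A.powersetCard 2 →
      L ∈ treeRedLines G ∧ L ∩ twinLeaves G = s ∧ L ≠ Set.univ := by
    intro s
    by_cases hs : s ∈ A.powersetCard 2
    · obtain ⟨hsA, hs2⟩ := Finset.mem_powersetCard.1 hs
      obtain ⟨y, z, hyz, rfl⟩ := Finset.card_eq_two.1 hs2
      have hy := hmemA.1 (hsA (by simp : y ∈ _))
      have hz := hmemA.1 (hsA (by simp : z ∈ _))
      refine ⟨treeRedLine G y z, fun _ => ⟨⟨y, z, hyz, rfl⟩, ?_,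
        treeRedLine_pair_ne_univ hconn hnotstar hy hz hyz⟩⟩
      rw [treeRedLine_inter_twinLeaves hconn hy hz hyz]
      simp
    · exact ⟨∅, fun h => absurd h hs⟩
  choose f hf using hpair
  have hsep : ∀ x : V, ∃ L : Set V, x ∈ A → L ∈ treeRedLines G ∧ x ∈ L ∧
      (∀ y, Twins G x y → y ∉ L) ∧
      ∀ y z, y ∈ L → y ∈ twinLeaves G → y ≠ x → Twins G y z → z ∈ L := by
    intro x
    by_cases hx : x ∈ A
    · obtain ⟨L, hL, h⟩ := exists_treeRedLine_separating_twins hconn hnotstar (hmemA.1 hx)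
      exact ⟨L, fun _ => ⟨hL, h⟩⟩
    · exact ⟨∅, fun h => absurd h hx⟩
  choose g hg using hsep
  have hfinj : Set.InjOn f (A.powersetCard 2) := fun s hs t ht hst => by
    have h1 := (hf s hs).2.1
    rw [hst, (hf t ht).2.1] at h1
    exact (Finset.coe_injective h1).symm
  have hginj : Set.InjOn g A := fun x hx y hy hxy => by
    by_contra hne
    obtain ⟨z, hz⟩ := (hmemA.1 hy).2
    have hyx : y ∈ g x := hxy ▸ (hg y hy).2.1
    have hzx := (hg x hx).2.2.2 y z hyx (hmemA.1 hy) (Ne.symm hne) hz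
    exact (hg y hy).2.2.1 z hz (hxy ▸ hzx)
  have hdisj : Disjoint ((A.powersetCard 2).image f) (A.image g) := by
    rw [Finset.disjoint_left]
    intro L hL hL'
    obtain ⟨s, hs, rfl⟩ := Finset.mem_image.1 hL
    obtain ⟨x, hx, hxs⟩ := Finset.mem_image.1 hL'
    have hmem : ∀ {v}, v ∈ s ↔ v ∈ g x ∧ v ∈ twinLeaves G := fun {v} => by
      rw [← Finset.mem_coe, ← (hf s hs).2.1, ← hxs, Set.mem_inter_iff]
    have hs2 := (Finset.mem_powersetCard.1 hs).2
    have hxmem : x ∈ s := hmem.2 ⟨(hg x hx).2.1, hmemA.1 hx⟩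
    obtain ⟨y, hy, hyx⟩ := Finset.exists_mem_ne (by omega : 1 < s.card) x
    obtain ⟨hyg, hyA⟩ := hmem.1 hy
    obtain ⟨z, hz⟩ := hyA.2
    have hzmem : z ∈ s :=
      hmem.2 ⟨(hg x hx).2.2.2 y z hyg hyA hyx hz, hz.mem_twinLeaves hyA⟩
    have hzx : z ≠ x := fun h => (hg x hx).2.2.1 y (h ▸ hz.symm) hyg
    have h3 : 2 < s.card :=
      Finset.two_lt_card.2 ⟨x, hxmem, y, hy, z, hzmem, hyx.symm, hzx.symm, hz.1⟩
    omega
  have huniv : Set.univ ∉ (A.powersetCard 2).image f ∪ A.image g := by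
    intro h
    rcases Finset.mem_union.1 h with h | h
    · obtain ⟨s, hs, h⟩ := Finset.mem_image.1 h
      exact (hf s hs).2.2 h
    · obtain ⟨x, hx, h⟩ := Finset.mem_image.1 h
      obtain ⟨y, hy⟩ := (hmemA.1 hx).2
      exact (hg x hx).2.2.1 y hy (h ▸ Set.mem_univ y)
  have hcount : (insert Set.univ ((A.powersetCard 2).image f ∪ A.image g)).card =
      A.card.choose 2 + A.card + 1 := by
    rw [Finset.card_insert_of_notMem huniv, Finset.card_union_of_disjoint hdisj,
      Finset.card_image_of_injOn hfinj, Finset.card_image_of_injOn hginj,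
      Finset.card_powersetCard]
  rw [← hcount, ← Set.ncard_coe_finset]
  refine Set.ncard_le_ncard (fun L hL => ?_) hfin
  rcases Finset.mem_insert.1 (Finset.mem_coe.1 hL) with rfl | hL
  · obtain ⟨c, hc⟩ := exists_neighborSet_eq_of_mem_twinLeaves (hmemA.1 hx₀)
    have hadj : c ∈ G.neighborSet x₀ := by simp [hc]
    exact ⟨x₀, c, G.ne_of_adj hadj, (treeRedLine_leaf_neighbor hconn hc).symm⟩
  rcases Finset.mem_union.1 hL with hL | hL
  · obtain ⟨s, hs, rfl⟩ := Finset.mem_image.1 hL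
    exact (hf s hs).1
  · obtain ⟨x, hx, rfl⟩ := Finset.mem_image.1 hL
    exact (hg x hx).1
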